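/- Let β ∈ (1, 2), A > 0 and set c_β = (β − 1)^{1/(1−β)}. Then the double integral ∫_{A+1}^{∞} ∫_{0}^{∞} r^{1−β} ( (t − A)^{1/(1−β)} − t^{1/(1−β)} ) exp( − c_β r t^{1/(1−β)} ) dr dt is finite. (Note that since 1/(1−β) < 0 and t > A + 1 > A, the factor (t − A)^{1/(1−β)} − t^{1/(1−β)} is positive, so the integrand is nonnegative.) -/

import Mathlib

open MeasureTheory Set Real

/-- A power decay bound for the increments of `t ↦ t ^ p`, from Bernoulli's inequality. -/
lemma rpow_sub_rpow_le_mul_rpow {p A t : ℝ} (hp : p ≤ -1) (hA : 0 < A) (ht : A + 1 < t) :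
    (t - A) ^ p - t ^ p ≤ -p * A * (A + 1) ^ (-p) * t ^ (p - 1) := by
  have ht0 : 0 < t := by linarith
  have hs : 0 < t - A := by linarith
  have hbern : 1 + -p * (-(A / t)) ≤ (1 + -(A / t)) ^ (-p) := by
    apply one_add_mul_self_le_rpow_one_add _ (by linarith)
    have : A / t ≤ 1 := (div_le_one ht0).2 (by linarith)
    linarith
  have hquot : 1 + -(A / t) = (t - A) / t := by field_simp; ring
  have hpow : (t - A) ^ p * ((t - A) / t) ^ (-p) = t ^ p := by
    rw [div_rpow hs.le ht0.le, rpow_neg hs.le, rpow_neg ht0.le]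
    have := (rpow_pos_of_pos hs p).ne'
    have := (rpow_pos_of_pos ht0 p).ne'
    field_simp
  have hdiff : (t - A) ^ p - t ^ p ≤ (t - A) ^ p * (-p * A / t) := by
    rw [hquot] at hbern
    have := mul_le_mul_of_nonneg_left hbern (rpow_pos_of_pos hs p).le
    rw [hpow] at this
    calc (t - A) ^ p - t ^ p ≤ (t - A) ^ p - (t - A) ^ p * (1 + -p * (-(A / t))) := by gcongr
      _ = (t - A) ^ p * (-p * A / t) := by ring
  have hcmp : (t - A) ^ p ≤ (A + 1) ^ (-p) * t ^ p := by
    have hle : t / (A + 1) ≤ t - A := by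
      rw [div_le_iff₀ (by linarith)]
      nlinarith
    calc (t - A) ^ p ≤ (t / (A + 1)) ^ p :=
          rpow_le_rpow_of_nonpos (by positivity) hle (by linarith)
      _ = (A + 1) ^ (-p) * t ^ p := by
          rw [div_rpow ht0.le (by positivity), rpow_neg (by positivity)]
          ring
  have hcoef : 0 ≤ -p * A / t := div_nonneg (mul_nonneg (by linarith) hA.le) ht0.le
  calc (t - A) ^ p - t ^ p ≤ (t - A) ^ p * (-p * A / t) := hdiff
    _ ≤ (A + 1) ^ (-p) * t ^ p * (-p * A / t) := by gcongr
    _ = -p * A * (A + 1) ^ (-p) * t ^ (p - 1) := by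
        rw [rpow_sub_one ht0.ne']
        ring

/-- The Gamma integral as a Lebesgue integral. -/
lemma lintegral_rpow_mul_exp_neg_mul_Ioi {a b d : ℝ} (ha : 0 < a) (hb : 0 < b) (hd : 0 ≤ d) :
    ∫⁻ r in Ioi (0 : ℝ), ENNReal.ofReal (d * (r ^ (a - 1) * exp (-(b * r)))) =
      ENNReal.ofReal (d * ((1 / b) ^ a * Gamma a)) := by
  have key := integral_rpow_mul_exp_neg_mul_Ioi ha hb
  have hint : IntegrableOn (fun r : ℝ ↦ r ^ (a - 1) * exp (-(b * r))) (Ioi 0) :=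
    .of_integral_ne_zero (by
      rw [key]
      have := Gamma_pos_of_pos ha
      positivity)
  rw [← key, ← integral_const_mul, ofReal_integral_eq_lintegral_ofReal (hint.const_mul d)]
  refine (ae_restrict_iff' measurableSet_Ioi).2 (ae_of_all _ fun r (hr : 0 < r) ↦ ?_)
  simp only [Pi.zero_apply]
  positivity

theorem stmt9
    (β : ℝ) (hβ : β ∈ Ioo (1 : ℝ) 2) (A : ℝ) (hA : 0 < A) :
    ∫⁻ t in Ioi (A + 1), ∫⁻ r in Ioi (0 : ℝ),
      ENNReal.ofReal (r ^ (1 - β) * ((t - A) ^ (1 / (1 - β)) - t ^ (1 / (1 - β))) *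
        Real.exp (-((β - 1) ^ (1 / (1 - β)) * r * t ^ (1 / (1 - β))))) < ⊤ := by
  obtain ⟨h1, h2⟩ := hβ
  have hmul : 1 / (1 - β) * (1 - β) = 1 := div_mul_cancel₀ 1 (by linarith)
  have hp : 1 / (1 - β) ≤ -1 := by
    rw [div_le_iff_of_neg (by linarith)]
    linarith
  have hc : 0 < (β - 1) ^ (1 / (1 - β)) := rpow_pos_of_pos (by linarith) _
  generalize 1 / (1 - β) = p at *
  generalize (β - 1) ^ p = c at *
  have hG : 0 < Gamma (2 - β) := Gamma_pos_of_pos (by linarith)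
  set K := -p * A * (A + 1) ^ (-p) * ((1 / c) ^ (2 - β) * Gamma (2 - β))
  have hint : IntegrableOn (fun t : ℝ ↦ K * t ^ (-2 : ℝ)) (Ioi (A + 1)) :=
    (integrableOn_Ioi_rpow_of_lt (by norm_num) (by linarith)).const_mul K
  refine lt_of_le_of_lt (setLIntegral_mono' measurableSet_Ioi fun t (ht : A + 1 < t) ↦ ?_)
    hint.lintegral_lt_top
  have ht0 : 0 < t := by linarith
  have htp := rpow_pos_of_pos ht0 p
  have hd : 0 ≤ (t - A) ^ p - t ^ p :=
    sub_nonneg.2 (rpow_le_rpow_of_nonpos (by linarith) (by linarith) (by linarith))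
  have hinner := lintegral_rpow_mul_exp_neg_mul_Ioi (a := 2 - β) (by linarith) (mul_pos hc htp) hd
  calc _ = ENNReal.ofReal (((t - A) ^ p - t ^ p) *
        ((1 / (c * t ^ p)) ^ (2 - β) * Gamma (2 - β))) := by
        rw [← hinner]
        refine lintegral_congr fun r ↦ ?_
        rw [show 2 - β - 1 = 1 - β by ring, show c * r * t ^ p = c * t ^ p * r by ring]
        congr 1
        ring
    _ ≤ ENNReal.ofReal (K * t ^ (-2 : ℝ)) := by
        apply ENNReal.ofReal_le_ofReal
        have hscale : (1 / (c * t ^ p)) ^ (2 - β) = (1 / c) ^ (2 - β) * t ^ (-p - 1) := by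
          rw [show 1 / (c * t ^ p) = 1 / c * t ^ (-p) by rw [rpow_neg ht0.le]; field_simp,
            mul_rpow (by positivity) (by positivity), ← rpow_mul ht0.le]
          congr 2
          linarith
        calc ((t - A) ^ p - t ^ p) * ((1 / (c * t ^ p)) ^ (2 - β) * Gamma (2 - β))
            ≤ -p * A * (A + 1) ^ (-p) * t ^ (p - 1) *
              ((1 / (c * t ^ p)) ^ (2 - β) * Gamma (2 - β)) := by
              gcongr
              exact rpow_sub_rpow_le_mul_rpow hp hA ht
          _ = K * (t ^ (p - 1) * t ^ (-p - 1)) := by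
              rw [hscale]
              ring
          _ = K * t ^ (-2 : ℝ) := by
              rw [← rpow_add ht0]
              congr 2
              ring
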